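/- arXiv:2504.18891 — 6 statements merged into one kernel-verified Lean document; each statement's English description precedes it below -/
import Mathlib

section
/- For all s,t ∈ ℕ and all n ≥ 1, the determinants τ_n^{s,t} of the bimoment matrices satisfy the discrete CKP equation: 4(τ_n^{s+1,t}τ_n^{s,t} − τ_{n+1}^{s,t}τ_{n−1}^{s+1,t})(τ_n^{s+1,t+1}τ_n^{s,t+1} − τ_{n+1}^{s,t+1}τ_{n−1}^{s+1,t+1}) = (τ_n^{s+1,t}τ_n^{s,t+1} + τ_n^{s+1,t+1}τ_n^{s,t} − τ_{n+1}^{s,t+1}τ_{n−1}^{s+1,t} − τ_{n+1}^{s,t}τ_{n−1}^{s+1,t+1})². -/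
open MeasureTheory

/-- Bimoments `m_{i,j}^{s,t}` of the Cauchy-Jacobi weight. -/
noncomputable def mom (s t i j : ℕ) : ℝ :=
  ∫ p in (Set.Ioo (0:ℝ) 1 ×ˢ Set.Ioo (0:ℝ) 1),
    (p.1 ^ (s + i) * p.2 ^ (s + j) / (p.1 + p.2)) *
      ((1 - p.1) / (1 + p.1)) ^ t * ((1 - p.2) / (1 + p.2)) ^ t

/-- Single moments `φ_i^{s,t} = L_{s,t}(x^i)`. -/
noncomputable def phi (s t i : ℕ) : ℝ :=
  Real.sqrt 2 * ∫ x in Set.Ioo (0:ℝ) 1,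
    (x ^ (s + i) / (1 + x)) * ((1 - x) / (1 + x)) ^ t

/-- Single moments `m_i^{s,t}`. -/
noncomputable def momS (s t i : ℕ) : ℝ :=
  ∫ x in Set.Ioo (0:ℝ) 1, x ^ (s + i) * ((1 - x) / (1 + x)) ^ t

/-- `τ_n^{s,t} = det(m_{i,j}^{s,t})_{i,j=0}^{n-1}` (with `τ_0^{s,t} = 1`). -/
noncomputable def tau (s t n : ℕ) : ℝ :=
  Matrix.det (Matrix.of fun i j : Fin n => mom s t i j)

/-- `ξ_n^{s,t} = det(m_{i,j+1}^{s,t})_{i,j=0}^{n-1}` (with `ξ_0^{s,t} = 1`). -/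
noncomputable def xi (s t n : ℕ) : ℝ :=
  Matrix.det (Matrix.of fun i j : Fin n => mom s t i ((j : ℕ) + 1))

/-- `σ_n^{s,t}`: determinant of the `(n+1)×(n+1)` matrix with first `n` columns the
bimoments and last column `(φ_0^{s,t},…,φ_n^{s,t})`. -/
noncomputable def sig (s t n : ℕ) : ℝ :=
  Matrix.det (Matrix.of fun i j : Fin (n + 1) =>
    if (j : ℕ) < n then mom s t i j else phi s t i)

/-- `ψ_n^{s,t}`: like `σ_n^{s,t}` but with shifted bimoments `m_{i,j+1}^{s,t}`. -/
noncomputable def psi (s t n : ℕ) : ℝ :=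
  Matrix.det (Matrix.of fun i j : Fin (n + 1) =>
    if (j : ℕ) < n then mom s t i ((j : ℕ) + 1) else phi s t i)

/-- `σ̃_n^{s,t}`: determinant of the `(n+1)×(n+1)` matrix with first `n` columns the
bimoments and last column the single moments `(m_0^{s,t},…,m_n^{s,t})`. -/
noncomputable def sigT (s t n : ℕ) : ℝ :=
  Matrix.det (Matrix.of fun i j : Fin (n + 1) =>
    if (j : ℕ) < n then mom s t i j else momS s t i)

/-- `τ̃_n^{s,t}`: determinant of the `n×n` matrix whose rows are the bimoment rows
`i = 0,…,n−2,n`. -/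
noncomputable def tauT (s t n : ℕ) : ℝ :=
  Matrix.det (Matrix.of fun i j : Fin n =>
    mom s t (if (i : ℕ) < n - 1 then (i : ℕ) else n) j)

/-- The monic Cauchy-Jacobi orthogonal polynomial `P_n^{s,t}` (as a real function). -/
noncomputable def P (s t n : ℕ) (x : ℝ) : ℝ :=
  (1 / tau s t n) * Matrix.det (Matrix.of fun i j : Fin (n + 1) =>
    if (j : ℕ) < n then mom s t i j else x ^ (i : ℕ))

/-- The adjacent monic polynomial `Q_n^{s,t}` (as a real function). -/
noncomputable def Q (s t n : ℕ) (x : ℝ) : ℝ :=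
  (1 / xi s t n) * Matrix.det (Matrix.of fun i j : Fin (n + 1) =>
    if (j : ℕ) < n then mom s t i ((j : ℕ) + 1) else x ^ (i : ℕ))

/-- The auxiliary monic polynomial `R_n^{s,t}` (as a real function): first column
`(φ_0,…,φ_n)`, next `n−1` columns the bimoments `m_{i,j}` for `j = 0,…,n−2`,
last column `(1,x,…,x^n)`, normalized by `(−1)^{n−1}/σ_{n−1}^{s,t}`. -/
noncomputable def R (s t n : ℕ) (x : ℝ) : ℝ :=
  ((-1 : ℝ) ^ (n - 1) / sig s t (n - 1)) *
    Matrix.det (Matrix.of fun i j : Fin (n + 1) =>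
      if (j : ℕ) = 0 then phi s t i
      else if (j : ℕ) < n then mom s t i ((j : ℕ) - 1) else x ^ (i : ℕ))

/-- The two-parameter deformed Cauchy inner product `⟨f,g⟩_{s,t}` on real functions. -/
noncomputable def innerF (s t : ℕ) (f g : ℝ → ℝ) : ℝ :=
  ∫ p in (Set.Ioo (0:ℝ) 1 ×ˢ Set.Ioo (0:ℝ) 1),
    (p.1 ^ s * p.2 ^ s / (p.1 + p.2)) * f p.1 * g p.2 *
      ((1 - p.1) / (1 + p.1)) ^ t * ((1 - p.2) / (1 + p.2)) ^ t

/-- The two-parameter deformed Cauchy inner product on real polynomials. -/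
noncomputable def innerP (s t : ℕ) (f g : Polynomial ℝ) : ℝ :=
  innerF s t (fun x => f.eval x) (fun y => g.eval y)

/-- The linear functional `L_{s,t}` on real functions. -/
noncomputable def LF (s t : ℕ) (f : ℝ → ℝ) : ℝ :=
  Real.sqrt 2 * ∫ x in Set.Ioo (0:ℝ) 1,
    (x ^ s / (1 + x)) * f x * ((1 - x) / (1 + x)) ^ t

/-- The linear functional `L_{s,t}` on real polynomials. -/
noncomputable def LP (s t : ℕ) (f : Polynomial ℝ) : ℝ := LF s t (fun x => f.eval x)

namespace Matrix

variable {R : Type*} [CommRing R]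

/-- Three-term Plücker relation for determinants with two replaced columns. -/
theorem det_mul_det_updateCol_updateCol {ι : Type*} [Fintype ι] [DecidableEq ι]
    (M : Matrix ι ι R) {i j : ι} (hij : i ≠ j) (u v : ι → R) :
    M.det * ((M.updateCol i u).updateCol j v).det =
      (M.updateCol i u).det * (M.updateCol j v).det -
        (M.updateCol i v).det * (M.updateCol j u).det := by
  have hu : M.det • u = ∑ k, M.cramer u k • M.col k := by
    rw [← mulVec_cramer M u, mulVec_eq_sum]
    exact Finset.sum_congr rfl fun k _ => by ext l; simp [mul_comm, col]
  have hswap : ((M.updateCol j v).updateCol i (M.col j)).det = -(M.updateCol i v).det := by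
    have h : (M.updateCol j v).updateCol i (M.col j) =
        (M.updateCol i v).submatrix id (Equiv.swap i j) := by
      ext a b
      rcases eq_or_ne b i with rfl | hbi
      · simp [hij.symm, col]
      · rcases eq_or_ne b j with rfl | hbj
        · simp [hij.symm]
        · simp [hbi, hbj, Equiv.swap_apply_of_ne_of_ne hbi hbj]
    rw [h, det_permute']
    simp [hij]
  have hself : (M.updateCol j v).updateCol i (M.col i) = M.updateCol j v := by
    rw [updateCol_comm M hij.symm]
    congr 1
    exact updateCol_eq_self M i
  rw [updateCol_comm M hij u v, ← det_updateCol_smul, hu, ← cramer_apply, map_sum,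
    Finset.sum_apply, Finset.sum_eq_add i j hij]
  · simp only [map_smul, Pi.smul_apply, smul_eq_mul]
    simp only [cramer_apply, hself, hswap]
    ring
  · rintro k - ⟨hki, hkj⟩
    rw [map_smul, Pi.smul_apply, cramer_apply (M.updateCol j v),
      det_zero_of_column_eq (i := i) (j := k) hki.symm fun l => by simp [hki, hkj, col], smul_zero]
  · simp
  · simp

/-- Expansion of a determinant along a column that is a standard basis vector. -/
theorem det_updateCol_single {n : ℕ} (M : Matrix (Fin (n + 1)) (Fin (n + 1)) R)
    (j k : Fin (n + 1)) :
    (M.updateCol j (Pi.single k 1)).det =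
      (-1) ^ (k + j : ℕ) * (M.submatrix k.succAbove j.succAbove).det := by
  rw [det_succ_column _ j, Finset.sum_eq_single k]
  · simp
  · intro b _ hb
    simp [hb]
  · simp

/-- The Desnanot–Jacobi identity. -/
theorem det_mul_det_interior {n : ℕ} (M : Matrix (Fin (n + 2)) (Fin (n + 2)) R) :
    M.det * (M.submatrix (fun i : Fin n => i.succ.castSucc) fun j => j.succ.castSucc).det =
      (M.submatrix Fin.succ Fin.succ).det * (M.submatrix Fin.castSucc Fin.castSucc).det -
        (M.submatrix Fin.castSucc Fin.succ).det * (M.submatrix Fin.succ Fin.castSucc).det := by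
  have h := det_mul_det_updateCol_updateCol M (i := 0) (j := Fin.last (n + 1))
    (Fin.last_pos.ne) (Pi.single 0 1) (Pi.single (Fin.last (n + 1)) 1)
  have hinner : (M.updateCol 0 (Pi.single 0 1)).submatrix Fin.castSucc Fin.castSucc =
      (M.submatrix Fin.castSucc Fin.castSucc).updateCol 0 (Pi.single (0 : Fin (n + 1)) 1) := by
    ext a b
    simp [updateCol_apply, Pi.single_apply]
  have hsign : ((-1 : R) ^ (n + 1)) * (-1) ^ (n + 1) = 1 := by
    rw [← mul_pow]; simp
  simp only [det_updateCol_single, Fin.succAbove_last, Fin.succAbove_zero, hinner,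
    submatrix_submatrix, Fin.val_last, Fin.val_zero, add_zero, zero_add, pow_zero, one_mul,
    pow_add (-1 : R) (n + 1) (n + 1), hsign] at h
  simp only [Function.comp_def] at h
  linear_combination h - (M.submatrix Fin.castSucc Fin.succ).det *
    (M.submatrix Fin.succ Fin.castSucc).det * hsign

/-- The determinant is affine along rank-one directions. -/
theorem det_add_vecMulVec_add_det_sub_vecMulVec {ι : Type*} [Fintype ι] [DecidableEq ι]
    (A : Matrix ι ι R) (u v : ι → R) :
    (A + vecMulVec u v).det + (A - vecMulVec u v).det = 2 * A.det := by
  let N : (ι → R) → Matrix (Unit ⊕ ι) (Unit ⊕ ι) R := fun w =>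
    fromBlocks 1 (replicateRow Unit w) (replicateCol Unit u) A
  have hN : ∀ w, (N w).det = (A - vecMulVec u w).det := fun w => by
    rw [det_fromBlocks_one₁₁, vecMulVec_eq Unit]
  have hrow : ∀ w, N w = (N 0).updateRow (Sum.inl ()) (Sum.elim 1 w) := fun w => by
    ext (i | i) (j | j) <;> simp [N, updateRow_apply]
  have hlin : (N (-v)).det + (N v).det = 2 * (N 0).det := by
    rw [hrow (-v), hrow v, hrow 0, ← det_updateRow_add, updateRow_idem,
      ← det_updateRow_smul]
    congr 2
    ext (i | i) <;> simp [one_add_one_eq_two]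
  rw [hN, hN, hN] at hlin
  simpa [vecMulVec_neg] using hlin

/-- Polarized Desnanot–Jacobi identity for a symmetric matrix and a symmetric rank-one
perturbation of it. -/
theorem IsSymm.desnanot_jacobi_polarized {n : ℕ} {A B : Matrix (Fin (n + 2)) (Fin (n + 2)) ℝ}
    (hA : A.IsSymm) (u : Fin (n + 2) → ℝ) (hB : B = A - vecMulVec u u) :
    let a := fun M : Matrix (Fin (n + 2)) (Fin (n + 2)) ℝ => (M.submatrix Fin.succ Fin.succ).det
    let b := fun M : Matrix (Fin (n + 2)) (Fin (n + 2)) ℝ =>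
      (M.submatrix Fin.castSucc Fin.castSucc).det
    let c := fun M : Matrix (Fin (n + 2)) (Fin (n + 2)) ℝ =>
      (M.submatrix (fun i : Fin n => i.succ.castSucc) fun j => j.succ.castSucc).det
    4 * ((a A * b A - A.det * c A) * (a B * b B - B.det * c B)) =
      (a A * b B + a B * b A - B.det * c A - A.det * c B) ^ 2 := by
  intro a b c
  let x := fun M : Matrix (Fin (n + 2)) (Fin (n + 2)) ℝ =>
    (M.submatrix Fin.castSucc Fin.succ).det
  have key : ∀ M : Matrix (Fin (n + 2)) (Fin (n + 2)) ℝ, M.IsSymm →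
      a M * b M - M.det * c M = x M ^ 2 := fun M hM => by
    have hx : (M.submatrix Fin.succ Fin.castSucc).det = x M := by
      rw [← det_transpose, transpose_submatrix, hM.eq]
    have := det_mul_det_interior M
    rw [hx] at this
    simp only [a, b, c, x] at this ⊢
    linear_combination -this
  have huu : (vecMulVec u u).IsSymm := by
    ext i j; simp [vecMulVec_apply, mul_comm]
  have hBs : B.IsSymm := hB ▸ hA.sub huu
  have hC := key (A + vecMulVec u u) (hA.add huu)
  have minor : ∀ (k : ℕ) (f g : Fin k → Fin (n + 2)),
      ((A + vecMulVec u u).submatrix f g).det = 2 * (A.submatrix f g).det -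
        (B.submatrix f g).det := fun k f g => by
    have := det_add_vecMulVec_add_det_sub_vecMulVec (A.submatrix f g) (u ∘ f) (u ∘ g)
    rw [eq_sub_iff_add_eq, ← this, hB]
    rfl
  have hdet : (A + vecMulVec u u).det = 2 * A.det - B.det := by
    simpa using minor _ id id
  have ha : a (A + vecMulVec u u) = 2 * a A - a B := minor _ _ _
  have hb : b (A + vecMulVec u u) = 2 * b A - b B := minor _ _ _
  have hc : c (A + vecMulVec u u) = 2 * c A - c B := minor _ _ _
  have hx : x (A + vecMulVec u u) = 2 * x A - x B := minor _ _ _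
  rw [ha, hb, hc, hx, hdet] at hC
  have hpol : a A * b B + a B * b A - B.det * c A - A.det * c B = 2 * x A * x B := by
    linear_combination 2 * key A hA + (1 / 2) * key B hBs - (1 / 2) * hC
  rw [hpol, key A hA, key B hBs]
  ring

end Matrix

/-- `1 / (x + y)` is dominated by a product that is integrable near the origin. -/
theorem inv_add_le_rpow_mul_rpow {x y : ℝ} (hx : 0 < x) (hy : 0 < y) :
    1 / (x + y) ≤ x ^ (-1 / 2 : ℝ) * y ^ (-1 / 2 : ℝ) := by
  rw [← Real.mul_rpow hx.le hy.le, neg_div, Real.rpow_neg (by positivity), ← Real.sqrt_eq_rpow,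
    one_div]
  refine inv_anti₀ (by positivity) (Real.sqrt_le_iff.2 ⟨by positivity, ?_⟩)
  nlinarith [mul_pos hx hy, sq_nonneg x, sq_nonneg y]

theorem integrableOn_mom (s t i j : ℕ) :
    IntegrableOn (fun p : ℝ × ℝ => (p.1 ^ (s + i) * p.2 ^ (s + j) / (p.1 + p.2)) *
      ((1 - p.1) / (1 + p.1)) ^ t * ((1 - p.2) / (1 + p.2)) ^ t)
      (Set.Ioo (0 : ℝ) 1 ×ˢ Set.Ioo (0 : ℝ) 1) := by
  have hr : IntegrableOn (fun x : ℝ => x ^ (-1 / 2 : ℝ)) (Set.Ioo 0 1) :=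
    (intervalIntegral.integrableOn_Ioo_rpow_iff one_pos).2 (by norm_num)
  have hg : IntegrableOn (fun p : ℝ × ℝ => p.1 ^ (-1 / 2 : ℝ) * p.2 ^ (-1 / 2 : ℝ))
      (Set.Ioo (0 : ℝ) 1 ×ˢ Set.Ioo (0 : ℝ) 1) := by
    rw [IntegrableOn, Measure.volume_eq_prod, ← Measure.prod_restrict]
    exact hr.mul_prod hr
  refine Integrable.mono' hg (Measurable.aestronglyMeasurable (by fun_prop)) ?_
  filter_upwards [ae_restrict_mem (measurableSet_Ioo.prod measurableSet_Ioo)]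
  rintro ⟨x, y⟩ ⟨⟨hx0, hx1⟩, hy0, hy1⟩
  dsimp only at *
  have hw : ∀ z : ℝ, 0 < z → z < 1 → 0 ≤ ((1 - z) / (1 + z)) ^ t ∧
      ((1 - z) / (1 + z)) ^ t ≤ 1 := fun z h0 h1 => by
    have h : 0 ≤ (1 - z) / (1 + z) := div_nonneg (by linarith) (by linarith)
    exact ⟨pow_nonneg h t, pow_le_one₀ h ((div_le_one (by linarith)).2 (by linarith))⟩
  obtain ⟨hwx, hwx'⟩ := hw x hx0 hx1
  obtain ⟨hwy, hwy'⟩ := hw y hy0 hy1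
  have hnum : x ^ (s + i) * y ^ (s + j) ≤ 1 :=
    mul_le_one₀ (pow_le_one₀ hx0.le hx1.le) (by positivity) (pow_le_one₀ hy0.le hy1.le)
  have hq : 0 ≤ x ^ (s + i) * y ^ (s + j) / (x + y) := by positivity
  rw [Real.norm_of_nonneg (by positivity)]
  calc _ ≤ x ^ (s + i) * y ^ (s + j) / (x + y) :=
        (mul_le_of_le_one_right (by positivity) hwy').trans (mul_le_of_le_one_right hq hwx')
    _ ≤ 1 / (x + y) := by gcongr
    _ ≤ _ := inv_add_le_rpow_mul_rpow hx0 hy0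

theorem integrableOn_phi (s t i : ℕ) :
    IntegrableOn (fun x : ℝ => (x ^ (s + i) / (1 + x)) * ((1 - x) / (1 + x)) ^ t)
      (Set.Ioo 0 1) := by
  have h : ∀ x ∈ Set.Icc (0 : ℝ) 1, 1 + x ≠ 0 := fun x hx => by linarith [hx.1]
  refine (ContinuousOn.integrableOn_Icc ?_).mono_set Set.Ioo_subset_Icc_self
  fun_prop (disch := assumption)

/-- Increasing `t` perturbs the bimoment matrix by a rank-one matrix. -/
theorem mom_succ_eq (s t i j : ℕ) :
    mom s (t + 1) i j = mom s t i j - phi s t i * phi s t j := by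
  have hphi : phi s t i * phi s t j = ∫ p in (Set.Ioo (0:ℝ) 1 ×ˢ Set.Ioo (0:ℝ) 1),
      2 * (((p.1 ^ (s + i) / (1 + p.1)) * ((1 - p.1) / (1 + p.1)) ^ t) *
        ((p.2 ^ (s + j) / (1 + p.2)) * ((1 - p.2) / (1 + p.2)) ^ t)) := by
    rw [integral_const_mul, Measure.volume_eq_prod,
      setIntegral_prod_mul (fun x : ℝ => (x ^ (s + i) / (1 + x)) * ((1 - x) / (1 + x)) ^ t)
        (fun y => (y ^ (s + j) / (1 + y)) * ((1 - y) / (1 + y)) ^ t), phi, phi]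
    linear_combination (∫ x in Set.Ioo (0:ℝ) 1, (x ^ (s + i) / (1 + x)) *
      ((1 - x) / (1 + x)) ^ t) * (∫ x in Set.Ioo (0:ℝ) 1, (x ^ (s + j) / (1 + x)) *
      ((1 - x) / (1 + x)) ^ t) * Real.mul_self_sqrt (zero_le_two (α := ℝ))
  have hint : IntegrableOn (fun p : ℝ × ℝ =>
      2 * (((p.1 ^ (s + i) / (1 + p.1)) * ((1 - p.1) / (1 + p.1)) ^ t) *
        ((p.2 ^ (s + j) / (1 + p.2)) * ((1 - p.2) / (1 + p.2)) ^ t)))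
      (Set.Ioo (0:ℝ) 1 ×ˢ Set.Ioo (0:ℝ) 1) := by
    rw [IntegrableOn, Measure.volume_eq_prod, ← Measure.prod_restrict]
    exact ((integrableOn_phi s t i).mul_prod (integrableOn_phi s t j)).const_mul 2
  rw [hphi, mom, mom, ← integral_sub (integrableOn_mom s t i j) hint]
  refine setIntegral_congr_fun (measurableSet_Ioo.prod measurableSet_Ioo) ?_
  rintro ⟨x, y⟩ ⟨⟨hx0, hx1⟩, hy0, hy1⟩
  dsimp only at *
  have h1 : 1 + x ≠ 0 := by positivity
  have h2 : 1 + y ≠ 0 := by positivity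
  have h3 : x + y ≠ 0 := by positivity
  rw [pow_succ, pow_succ]
  generalize ((1 - x) / (1 + x)) ^ t = w
  generalize ((1 - y) / (1 + y)) ^ t = z
  field_simp
  ring

theorem mom_comm (s t i j : ℕ) : mom s t i j = mom s t j i := by
  rw [mom, mom, Measure.volume_eq_prod, ← setIntegral_prod_swap]
  refine integral_congr_ae (Filter.Eventually.of_forall fun p => ?_)
  simp only [Prod.fst_swap, Prod.snd_swap]
  rw [add_comm p.2 p.1]
  ring

theorem mom_succ_left (s t i j : ℕ) : mom (s + 1) t i j = mom s t (i + 1) (j + 1) := by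
  simp only [mom, add_assoc, add_comm 1]

/-- the normalization factors `τ_n^{s,t}` of the Cauchy-Jacobi bimoment
matrices satisfy the discrete CKP equation. -/
theorem tau_satisfies_discrete_CKP (s t n : ℕ) (hn : 1 ≤ n) :
    4 * ((tau (s + 1) t n * tau s t n - tau s t (n + 1) * tau (s + 1) t (n - 1)) *
        (tau (s + 1) (t + 1) n * tau s (t + 1) n -
          tau s (t + 1) (n + 1) * tau (s + 1) (t + 1) (n - 1))) =
      (tau (s + 1) t n * tau s (t + 1) n + tau (s + 1) (t + 1) n * tau s t n -
        tau s (t + 1) (n + 1) * tau (s + 1) t (n - 1) -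
        tau s t (n + 1) * tau (s + 1) (t + 1) (n - 1)) ^ 2 := by
  obtain ⟨m, rfl⟩ : ∃ m, n = m + 1 := ⟨n - 1, by omega⟩
  have h := Matrix.IsSymm.desnanot_jacobi_polarized (n := m)
    (A := Matrix.of fun i j => mom s t i j) (B := Matrix.of fun i j => mom s (t + 1) i j)
    (by ext i j; exact mom_comm s t j i) (fun i => phi s t i)
    (by ext i j; exact mom_succ_eq s t i j)
  simp only [tau, mom_succ_left]
  exact h
end

section
/- (Andréief/Cauchy-determinant formula) For all s,t ∈ ℕ and n ≥ 1, τ_n^{s,t} equals the multiple integral over the ordered region 0 < x_1 < ⋯ < x_n < 1, 0 < y_1 < ⋯ < y_n < 1 of ∏_{i=1}^n x_i^s y_i^s · ∏_{i,j=1}^n 1/(x_i + y_j) · ∏_{1≤i<j≤n} (x_i − x_j)²(y_i − y_j)² · ∏_{i=1}^n ((1−x_i)/(1+x_i))^t ((1−y_i)/(1+y_i))^t dx_1⋯dx_n dy_1⋯dy_n. -/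
open MeasureTheory

theorem Matrix.det_of_inv_add {F : Type*} [Field F] {n : ℕ} (x y : Fin n → F)
    (h : ∀ i j, x i + y j ≠ 0) :
    Matrix.det (Matrix.of fun i j => (x i + y j)⁻¹) =
      (∏ i, ∏ j ∈ Finset.Ioi i, (x j - x i) * (y j - y i)) * ∏ i, ∏ j, (x i + y j)⁻¹ := by
  induction n with
  | zero => simp
  | succ n ih =>
    let B : Matrix (Fin (n + 1)) (Fin (n + 1)) F := Matrix.of <|
      Fin.cons (fun j => (x 0 + y j)⁻¹) fun i j =>
        (x i.succ - x 0) / (x i.succ + y 0) * ((y j - y 0) / (x 0 + y j) * (x i.succ + y j)⁻¹)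
    have key : Matrix.det (Matrix.of fun i j => (x i + y j)⁻¹) = B.det := by
      refine Matrix.det_eq_of_forall_row_eq_smul_add_const
        (Fin.cons 0 fun i => (x 0 + y 0) / (x i.succ + y 0)) 0 rfl fun i j => ?_
      induction i using Fin.cases with
      | zero => simp [B]
      | succ i =>
        have h1 := h i.succ j
        have h2 := h i.succ 0
        have h3 := h 0 j
        simp only [B, Matrix.of_apply, Fin.cons_succ, Fin.cons_zero]
        field_simp
        ring
    have hsub : (B.submatrix Fin.succ Fin.succ).det =
        (∏ i : Fin n, (x i.succ - x 0) / (x i.succ + y 0)) *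
          ((∏ j : Fin n, (y j.succ - y 0) / (x 0 + y j.succ)) *
            Matrix.det (Matrix.of fun i j : Fin n => (x i.succ + y j.succ)⁻¹)) := by
      rw [← Matrix.det_mul_row, ← Matrix.det_mul_column]
      rfl
    rw [key, Matrix.det_succ_column_zero, Fin.sum_univ_succ, Finset.sum_eq_zero]
    · rw [Fin.succAbove_zero, hsub, ih (fun i => x i.succ) (fun i => y i.succ)
        (fun i j => h _ _)]
      simp only [B, Fin.prod_univ_succ, Fin.prod_Ioi_zero, Fin.prod_Ioi_succ, Matrix.of_apply,
        Fin.cons_zero, Finset.prod_mul_distrib, div_eq_mul_inv, Fin.val_zero, pow_zero]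
      ring
    · intro i _
      simp [B]

theorem Matrix.sum_perm_prod_eq_det_mul_det_mul_det {R ι : Type*} [CommRing R] [Fintype ι]
    [DecidableEq ι] (A B K : Matrix ι ι R) :
    ∑ p : Equiv.Perm ι × Equiv.Perm ι, ∑ σ : Equiv.Perm ι, ((σ.sign : ℤ) : R) *
      ∏ i, (A (p.1 i) (σ i) * B (p.2 i) i * K (p.1 i) (p.2 i)) = A.det * B.det * K.det := by
  have h1 : ∀ α : Equiv.Perm ι, ∑ σ : Equiv.Perm ι, ((σ.sign : ℤ) : R) * ∏ i, A (α i) (σ i) =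
      ((α.sign : ℤ) : R) * A.det := fun α => by
    rw [← Matrix.det_permute, ← Matrix.det_transpose, Matrix.det_apply']
    rfl
  have h2 : ∀ β : Equiv.Perm ι, ∑ α : Equiv.Perm ι, ((α.sign : ℤ) : R) * ∏ i, K (α i) (β i) =
      ((β.sign : ℤ) : R) * K.det := fun β => by
    rw [← Matrix.det_permute', Matrix.det_apply']
    simp
  simp only [Finset.prod_mul_distrib, ← mul_assoc, ← Finset.sum_mul, h1]
  rw [Fintype.sum_prod_type_right]
  calc _ = ∑ β : Equiv.Perm ι, A.det * (∏ i, B (β i) i) *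
        ∑ α : Equiv.Perm ι, ((α.sign : ℤ) : R) * ∏ i, K (α i) (β i) := by
        simp only [Finset.mul_sum]
        exact Finset.sum_congr rfl fun _ _ => Finset.sum_congr rfl fun _ _ => by ring
    _ = A.det * (∑ β : Equiv.Perm ι, ((β.sign : ℤ) : R) * ∏ i, B (β i) i) * K.det := by
        simp only [h2, Finset.mul_sum, Finset.sum_mul]
        exact Finset.sum_congr rfl fun _ _ => by ring
    _ = _ := by rw [← Matrix.det_apply']

theorem measurableSet_setOf_strictMono (n : ℕ) :
    MeasurableSet {x : Fin n → ℝ | StrictMono x} := by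
  simp only [StrictMono, Set.ofPred_forall]
  exact .iInter fun i => .iInter fun j => .iInter fun _ =>
    measurableSet_lt (measurable_pi_apply i) (measurable_pi_apply j)

theorem ae_injective (n : ℕ) : ∀ᵐ x : Fin n → ℝ, Function.Injective x := by
  have h : ∀ i j : Fin n, i ≠ j → ∀ᵐ x : Fin n → ℝ, x i ≠ x j := fun i j hij => by
    let f : (Fin n → ℝ) →ₗ[ℝ] ℝ := (LinearMap.proj i : (Fin n → ℝ) →ₗ[ℝ] ℝ) - LinearMap.proj j
    have hf : LinearMap.ker f ≠ ⊤ := fun h => by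
      have h1 : f (Pi.single i 1) = 0 := by
        rw [LinearMap.ker_eq_top.1 h]; rfl
      simp [f, hij.symm] at h1
    have := Measure.addHaar_submodule volume _ hf
    rw [ae_iff]
    convert this using 2
    ext x
    simp [f, sub_eq_zero]
  have h' : ∀ᵐ x : Fin n → ℝ, ∀ i j, i ≠ j → x i ≠ x j := by
    simpa only [ae_all_iff] using h
  filter_upwards [h'] with x hx i j hij
  by_contra hne
  exact hx i j hne hij

theorem exists_perm_strictMono {n : ℕ} {x : Fin n → ℝ} (hx : Function.Injective x) :
    ∃ σ : Equiv.Perm (Fin n), StrictMono (x ∘ σ) :=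
  ⟨Tuple.sort x, (Tuple.monotone_sort x).strictMono_of_injective (hx.comp (Equiv.injective _))⟩

theorem perm_eq_of_strictMono {n : ℕ} {x : Fin n → ℝ} {σ τ : Equiv.Perm (Fin n)}
    (hσ : StrictMono (x ∘ σ)) (hτ : StrictMono (x ∘ τ)) : σ = τ := by
  have hx : Function.Injective x := by
    have := hσ.injective.comp σ.symm.injective
    simpa [Function.comp_assoc] using this
  exact Equiv.coe_fn_injective
    (hx.comp_left (Tuple.unique_monotone hσ.monotone hτ.monotone))

theorem measurePreserving_comp_perm {n : ℕ} (σ : Equiv.Perm (Fin n)) :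
    MeasurePreserving fun x : Fin n → ℝ => x ∘ σ := by
  have h : (fun x : Fin n → ℝ => x ∘ σ) =
      MeasurableEquiv.piCongrLeft (fun _ : Fin n => ℝ) σ.symm := by
    ext x i
    obtain ⟨i, rfl⟩ := σ.symm.surjective i
    rw [MeasurableEquiv.piCongrLeft_apply_apply]
    simp
  rw [h]
  exact volume_measurePreserving_piCongrLeft _ _

theorem integral_eq_setIntegral_strictMono {n : ℕ} {f : (Fin n → ℝ) × (Fin n → ℝ) → ℝ}
    (hf : Integrable f) :
    ∫ q, f q = ∫ q in {q : (Fin n → ℝ) × (Fin n → ℝ) | StrictMono q.1 ∧ StrictMono q.2},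
      ∑ p : Equiv.Perm (Fin n) × Equiv.Perm (Fin n), f (q.1 ∘ p.1, q.2 ∘ p.2) := by
  let S : Set ((Fin n → ℝ) × (Fin n → ℝ)) := {q | StrictMono q.1 ∧ StrictMono q.2}
  have hS : MeasurableSet S := (measurableSet_setOf_strictMono n).prod
    (measurableSet_setOf_strictMono n)
  let e (p : Equiv.Perm (Fin n) × Equiv.Perm (Fin n)) :
      (Fin n → ℝ) × (Fin n → ℝ) → (Fin n → ℝ) × (Fin n → ℝ) :=
    Prod.map (fun x => x ∘ p.1) (fun x => x ∘ p.2)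
  have he : ∀ p, MeasurePreserving (e p) := fun p =>
    (measurePreserving_comp_perm p.1).prod (measurePreserving_comp_perm p.2)
  have hinv : ∀ p q, e p (e p⁻¹ q) = q := fun p q => by
    ext <;> simp [e]
  have hinv' : ∀ p q, e p⁻¹ (e p q) = q := fun p q => by
    ext <;> simp [e]
  let E (p : Equiv.Perm (Fin n) × Equiv.Perm (Fin n)) :
      (Fin n → ℝ) × (Fin n → ℝ) ≃ᵐ (Fin n → ℝ) × (Fin n → ℝ) :=
    { toFun := e p
      invFun := e p⁻¹
      left_inv := hinv' p
      right_inv := hinv p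
      measurable_toFun := (he p).measurable
      measurable_invFun := (he p⁻¹).measurable }
  have hemb : ∀ p, MeasurableEmbedding (e p) := fun p => (E p).measurableEmbedding
  have hcover : ∀ᵐ q : (Fin n → ℝ) × (Fin n → ℝ), q ∈ ⋃ p, e p ⁻¹' S := by
    filter_upwards [Measure.quasiMeasurePreserving_fst.ae (ae_injective n),
      Measure.quasiMeasurePreserving_snd.ae (ae_injective n)] with q h1 h2
    obtain ⟨σ, hσ⟩ := exists_perm_strictMono h1
    obtain ⟨τ, hτ⟩ := exists_perm_strictMono h2
    exact Set.mem_iUnion.2 ⟨(σ, τ), hσ, hτ⟩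
  have hdisj : Pairwise (Function.onFun Disjoint fun p => e p ⁻¹' S) := fun p p' hne =>
    Set.disjoint_left.2 fun q hq hq' => hne <|
      Prod.ext (perm_eq_of_strictMono hq.1 hq'.1) (perm_eq_of_strictMono hq.2 hq'.2)
  calc ∫ q, f q = ∫ q in ⋃ p, e p ⁻¹' S, f q := by
        rw [Measure.restrict_eq_self_of_ae_mem hcover]
    _ = ∑ p, ∫ q in e p ⁻¹' S, f q :=
        integral_iUnion_fintype (fun p => (he p).measurable hS) hdisj fun p => hf.integrableOn
    _ = ∑ p, ∫ q in S, f (e p⁻¹ q) := Finset.sum_congr rfl fun p _ => by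
        rw [← (he p).setIntegral_preimage_emb (hemb p) (fun q => f (e p⁻¹ q))]
        simp only [hinv']
    _ = ∑ p, ∫ q in S, f (e p q) := 
        Equiv.sum_comp (Equiv.inv (Equiv.Perm (Fin n) × Equiv.Perm (Fin n))) fun p => ∫ q in S, f (e p q)
    _ = ∫ q in S, ∑ p, f (e p q) := (integral_finsetSum _ fun p _ =>
        (((he p).integrable_comp_emb (hemb p)).2 hf).integrableOn).symm

/-- Two-kernel version of the **Andréief identity**. -/
theorem det_integral_mul_mul_eq {n : ℕ} (φ ψ : Fin n → ℝ → ℝ) (K : ℝ × ℝ → ℝ)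
    (hint : ∀ i j, Integrable fun p : ℝ × ℝ => φ i p.1 * ψ j p.2 * K p) :
    Matrix.det (Matrix.of fun i j => ∫ p : ℝ × ℝ, φ i p.1 * ψ j p.2 * K p) =
      ∫ q in {q : (Fin n → ℝ) × (Fin n → ℝ) | StrictMono q.1 ∧ StrictMono q.2},
        Matrix.det (Matrix.of fun i j => φ j (q.1 i)) *
          Matrix.det (Matrix.of fun i j => ψ j (q.2 i)) *
          Matrix.det (Matrix.of fun i j => K (q.1 i, q.2 j)) := by
  have hmp := volume_measurePreserving_arrowProdEquivProdArrow ℝ ℝ (Fin n)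
  have hterm : ∀ σ : Equiv.Perm (Fin n), Integrable
      fun q : (Fin n → ℝ) × (Fin n → ℝ) => ((σ.sign : ℤ) : ℝ) *
        ∏ i, (φ (σ i) (q.1 i) * ψ i (q.2 i) * K (q.1 i, q.2 i)) := fun σ => by
    refine Integrable.const_mul ?_ _
    rw [← hmp.integrable_comp_emb (MeasurableEquiv.measurableEmbedding _)]
    exact Integrable.fintype_prod (E := ℝ × ℝ)
      (f := fun i p => φ (σ i) p.1 * ψ i p.2 * K p) fun i => hint (σ i) i
  calc _ = ∑ σ : Equiv.Perm (Fin n), ∫ q : (Fin n → ℝ) × (Fin n → ℝ), ((σ.sign : ℤ) : ℝ) *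
        ∏ i, (φ (σ i) (q.1 i) * ψ i (q.2 i) * K (q.1 i, q.2 i)) := by
        rw [Matrix.det_apply']
        refine Finset.sum_congr rfl fun σ _ => ?_
        rw [integral_const_mul, ← hmp.integral_comp']
        congr 1
        exact (integral_fintype_prod_volume_eq_prod (E := fun _ : Fin n => ℝ × ℝ)
          fun i p => φ (σ i) p.1 * ψ i p.2 * K p).symm
    _ = ∫ q : (Fin n → ℝ) × (Fin n → ℝ), ∑ σ : Equiv.Perm (Fin n), ((σ.sign : ℤ) : ℝ) *
        ∏ i, (φ (σ i) (q.1 i) * ψ i (q.2 i) * K (q.1 i, q.2 i)) :=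
        (integral_finsetSum _ fun σ _ => hterm σ).symm
    _ = _ := by
        rw [integral_eq_setIntegral_strictMono (integrable_finsetSum _ fun σ _ => hterm σ)]
        congr 1
        ext q
        exact Matrix.sum_perm_prod_eq_det_mul_det_mul_det
          (Matrix.of fun i j => φ j (q.1 i)) (Matrix.of fun i j => ψ j (q.2 i))
          (Matrix.of fun i j => K (q.1 i, q.2 j))

theorem integrableOn_inv_add_Ioo :
    IntegrableOn (fun p : ℝ × ℝ => (p.1 + p.2)⁻¹) (Set.Ioo 0 1 ×ˢ Set.Ioo 0 1) := by
  have h1 : IntegrableOn (fun x : ℝ => x ^ (-(1 / 2) : ℝ)) (Set.Ioo 0 1) :=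
    (intervalIntegral.integrableOn_Ioo_rpow_iff one_pos).2 (by norm_num)
  have h2 : IntegrableOn (fun p : ℝ × ℝ => p.1 ^ (-(1 / 2) : ℝ) * p.2 ^ (-(1 / 2) : ℝ))
      (Set.Ioo 0 1 ×ˢ Set.Ioo 0 1) := by
    rw [IntegrableOn, Measure.volume_eq_prod, ← Measure.prod_restrict]
    exact h1.mul_prod h1
  refine h2.mono' (by fun_prop) ?_
  filter_upwards [ae_restrict_mem (measurableSet_Ioo.prod measurableSet_Ioo)] with p hp
  obtain ⟨⟨hx, -⟩, hy, -⟩ := hp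
  rw [Real.norm_of_nonneg (by positivity), Real.rpow_neg hx.le, Real.rpow_neg hy.le,
    ← mul_inv, ← Real.sqrt_eq_rpow, ← Real.sqrt_eq_rpow]
  refine inv_anti₀ (by positivity) ?_
  nlinarith [sq_nonneg (√p.1 - √p.2), Real.sq_sqrt hx.le, Real.sq_sqrt hy.le,
    mul_pos (Real.sqrt_pos.2 hx) (Real.sqrt_pos.2 hy)]

/-- The weight `x ^ s * ((1 - x) / (1 + x)) ^ t`. -/
noncomputable def cauchyJacobiWeight (s t : ℕ) (x : ℝ) : ℝ := x ^ s * ((1 - x) / (1 + x)) ^ t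

/-- The Cauchy-Jacobi kernel, extended by zero outside the open unit square. -/
noncomputable def cauchyJacobiKernel (s t : ℕ) : ℝ × ℝ → ℝ :=
  (Set.Ioo (0 : ℝ) 1 ×ˢ Set.Ioo (0 : ℝ) 1).indicator fun p =>
    cauchyJacobiWeight s t p.1 * (cauchyJacobiWeight s t p.2 * (p.1 + p.2)⁻¹)

theorem pow_mul_pow_mul_cauchyJacobiKernel (s t i j : ℕ) :
    (fun p : ℝ × ℝ => p.1 ^ i * p.2 ^ j * cauchyJacobiKernel s t p) =
      (Set.Ioo (0 : ℝ) 1 ×ˢ Set.Ioo (0 : ℝ) 1).indicator fun p =>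
        (p.1 ^ (s + i) * p.2 ^ (s + j) / (p.1 + p.2)) *
          ((1 - p.1) / (1 + p.1)) ^ t * ((1 - p.2) / (1 + p.2)) ^ t := by
  ext p
  by_cases hp : p ∈ Set.Ioo (0 : ℝ) 1 ×ˢ Set.Ioo (0 : ℝ) 1
  · simp only [cauchyJacobiKernel, cauchyJacobiWeight, Set.indicator_of_mem hp]
    ring
  · simp only [cauchyJacobiKernel, Set.indicator_of_notMem hp, mul_zero]

theorem norm_one_sub_div_one_add_le_one {x : ℝ} (hx : x ∈ Set.Ioo (0 : ℝ) 1) :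
    ‖(1 - x) / (1 + x)‖ ≤ 1 := by
  obtain ⟨h0, h1⟩ := hx
  rw [Real.norm_of_nonneg (div_nonneg (by linarith) (by linarith)), div_le_one (by linarith)]
  linarith

theorem norm_le_one_of_mem_Ioo {x : ℝ} (hx : x ∈ Set.Ioo (0 : ℝ) 1) : ‖x‖ ≤ 1 := by
  rw [Real.norm_of_nonneg hx.1.le]
  exact hx.2.le

theorem integrable_pow_mul_pow_mul_cauchyJacobiKernel (s t i j : ℕ) :
    Integrable fun p : ℝ × ℝ => p.1 ^ i * p.2 ^ j * cauchyJacobiKernel s t p := by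
  have hmeas : MeasurableSet (Set.Ioo (0 : ℝ) 1 ×ˢ Set.Ioo (0 : ℝ) 1) :=
    measurableSet_Ioo.prod measurableSet_Ioo
  rw [pow_mul_pow_mul_cauchyJacobiKernel, integrable_indicator_iff hmeas]
  refine Integrable.mono integrableOn_inv_add_Ioo (by fun_prop) ?_
  filter_upwards [ae_restrict_mem hmeas] with p hp
  have hx := norm_le_one_of_mem_Ioo hp.1
  have hy := norm_le_one_of_mem_Ioo hp.2
  have hx' := norm_one_sub_div_one_add_le_one hp.1
  have hy' := norm_one_sub_div_one_add_le_one hp.2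
  rw [div_eq_mul_inv, norm_mul, norm_mul, norm_mul, norm_mul, norm_pow, norm_pow, norm_pow,
    norm_pow]
  calc _ ≤ 1 * 1 * ‖(p.1 + p.2)⁻¹‖ * 1 * 1 := by
        gcongr <;> exact pow_le_one₀ (norm_nonneg _) ‹_›
    _ = _ := by ring

theorem det_cauchyJacobiKernel {n : ℕ} (s t : ℕ) {x y : Fin n → ℝ}
    (hx : ∀ i, x i ∈ Set.Ioo (0 : ℝ) 1) (hy : ∀ i, y i ∈ Set.Ioo (0 : ℝ) 1) :
    Matrix.det (Matrix.of fun i j => cauchyJacobiKernel s t (x i, y j)) =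
      (∏ i, cauchyJacobiWeight s t (x i)) * ((∏ j, cauchyJacobiWeight s t (y j)) *
        ((∏ i, ∏ j ∈ Finset.Ioi i, (x j - x i) * (y j - y i)) *
          ∏ i, ∏ j, (x i + y j)⁻¹)) := by
  rw [← Matrix.det_of_inv_add x y fun i j => (add_pos (hx i).1 (hy j).1).ne',
    ← Matrix.det_mul_row, ← Matrix.det_mul_column]
  congr 1
  ext i j
  rw [Matrix.of_apply, cauchyJacobiKernel, Set.indicator_of_mem (Set.mk_mem_prod (hx i) (hy j))]
  rfl

theorem det_cauchyJacobiKernel_eq_zero {n : ℕ} (s t : ℕ) {x y : Fin n → ℝ}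
    (h : ¬((∀ i, x i ∈ Set.Ioo (0 : ℝ) 1) ∧ ∀ i, y i ∈ Set.Ioo (0 : ℝ) 1)) :
    Matrix.det (Matrix.of fun i j => cauchyJacobiKernel s t (x i, y j)) = 0 := by
  rw [not_and_or, not_forall, not_forall] at h
  rcases h with ⟨i, hi⟩ | ⟨j, hj⟩
  · refine Matrix.det_eq_zero_of_row_eq_zero i fun j => ?_
    rw [Matrix.of_apply, cauchyJacobiKernel, Set.indicator_of_notMem fun h => hi h.1]
  · refine Matrix.det_eq_zero_of_column_eq_zero j fun i => ?_
    rw [Matrix.of_apply, cauchyJacobiKernel, Set.indicator_of_notMem fun h => hj h.2]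

/-- Andréief formula: `τ_n^{s,t}` equals a multiple integral over the
ordered configuration space `0 < x_1 < ⋯ < x_n < 1`, `0 < y_1 < ⋯ < y_n < 1`. -/
theorem andreief_formula (s t n : ℕ) (hn : 1 ≤ n) :
    tau s t n =
      ∫ p in {q : (Fin n → ℝ) × (Fin n → ℝ) |
          StrictMono q.1 ∧ StrictMono q.2 ∧
          (∀ i, q.1 i ∈ Set.Ioo (0:ℝ) 1) ∧ (∀ i, q.2 i ∈ Set.Ioo (0:ℝ) 1)},
        (∏ i, p.1 i ^ s * p.2 i ^ s) *
          (∏ i, ∏ j, (p.1 i + p.2 j)⁻¹) *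
          (∏ i, ∏ j ∈ Finset.Ioi i, (p.1 i - p.1 j) ^ 2 * (p.2 i - p.2 j) ^ 2) *
          ∏ i, ((1 - p.1 i) / (1 + p.1 i)) ^ t * ((1 - p.2 i) / (1 + p.2 i)) ^ t := by
  have hS : MeasurableSet {q : (Fin n → ℝ) × (Fin n → ℝ) | StrictMono q.1 ∧ StrictMono q.2} :=
    (measurableSet_setOf_strictMono n).prod (measurableSet_setOf_strictMono n)
  have hbox : MeasurableSet {q : (Fin n → ℝ) × (Fin n → ℝ) | StrictMono q.1 ∧ StrictMono q.2 ∧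
      (∀ i, q.1 i ∈ Set.Ioo (0:ℝ) 1) ∧ (∀ i, q.2 i ∈ Set.Ioo (0:ℝ) 1)} := by
    have hI (i : Fin n) : MeasurableSet {x : Fin n → ℝ | x i ∈ Set.Ioo (0:ℝ) 1} :=
      measurable_pi_apply i measurableSet_Ioo
    have hcube : MeasurableSet {x : Fin n → ℝ | ∀ i, x i ∈ Set.Ioo (0:ℝ) 1} := by
      simpa only [Set.ofPred_forall] using MeasurableSet.iInter hI
    convert hS.inter (hcube.prod hcube) using 1
    ext q
    simp [and_assoc]
  have htau : tau s t n = Matrix.det (Matrix.of fun i j : Fin n =>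
      ∫ p : ℝ × ℝ, p.1 ^ (i : ℕ) * p.2 ^ (j : ℕ) * cauchyJacobiKernel s t p) := by
    rw [tau]
    congr 1
    ext i j
    simp only [Matrix.of_apply, mom]
    rw [pow_mul_pow_mul_cauchyJacobiKernel,
      integral_indicator (measurableSet_Ioo.prod measurableSet_Ioo)]
  rw [htau, det_integral_mul_mul_eq (fun i x => x ^ (i : ℕ)) (fun i x => x ^ (i : ℕ)) _
    fun i j => integrable_pow_mul_pow_mul_cauchyJacobiKernel s t i j]
  have hsub : {q : (Fin n → ℝ) × (Fin n → ℝ) | StrictMono q.1 ∧ StrictMono q.2 ∧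
      (∀ i, q.1 i ∈ Set.Ioo (0:ℝ) 1) ∧ (∀ i, q.2 i ∈ Set.Ioo (0:ℝ) 1)} ⊆
      {q | StrictMono q.1 ∧ StrictMono q.2} := fun q hq => ⟨hq.1, hq.2.1⟩
  rw [setIntegral_eq_of_subset_of_forall_sdiff_eq_zero hS hsub]
  · refine setIntegral_congr_fun hbox ?_
    rintro q ⟨-, -, hx, hy⟩
    have hvand (x : Fin n → ℝ) : Matrix.det (Matrix.of fun i j : Fin n => x i ^ (j : ℕ)) =
        ∏ i, ∏ j ∈ Finset.Ioi i, (x j - x i) := Matrix.det_vandermonde x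
    have hsq : (∏ i, ∏ j ∈ Finset.Ioi i, (q.1 i - q.1 j) ^ 2 * (q.2 i - q.2 j) ^ 2) =
        ((∏ i, ∏ j ∈ Finset.Ioi i, (q.1 j - q.1 i)) *
          ∏ i, ∏ j ∈ Finset.Ioi i, (q.2 j - q.2 i)) ^ 2 := by
      simp only [← Finset.prod_mul_distrib, ← Finset.prod_pow]
      exact Finset.prod_congr rfl fun _ _ => Finset.prod_congr rfl fun _ _ => by ring
    dsimp only
    rw [hsq, hvand, hvand, det_cauchyJacobiKernel s t hx hy]
    simp only [cauchyJacobiWeight, Finset.prod_mul_distrib]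
    ring
  · intro q hq
    rw [det_cauchyJacobiKernel_eq_zero s t fun h => hq.2 ⟨hq.1.1, hq.1.2, h⟩, mul_zero]
end

section
/- For all s,t ∈ ℕ and all n ∈ ℕ, both determinants are strictly positive: τ_n^{s,t} > 0 and ξ_n^{s,t} > 0. In particular the normalization constants h_n^{s,t} = τ_{n+1}^{s,t}/τ_n^{s,t} of the deformed Cauchy orthogonal polynomials are nonzero. -/
open MeasureTheory

open Set Matrix

/-- The product of a Cauchy determinant with the two Vandermonde determinants of its
(positive, pairwise distinct) nodes is positive. -/
lemma det_cauchy_mul_vandermonde_pos {n : ℕ} (x y : Fin n → ℝ) (hx : ∀ i, 0 < x i)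
    (hy : ∀ i, 0 < y i) (hxi : Function.Injective x) (hyi : Function.Injective y) :
    0 < (vandermonde x).det * (vandermonde y).det *
      (of fun i j : Fin n => 1 / (x i + y j)).det := by
  induction n with
  | zero => simp
  | succ n ih =>
    have vand : ∀ z : Fin (n + 1) → ℝ, (vandermonde z).det =
        (∏ i : Fin n, (z i.succ - z 0)) * (vandermonde fun i : Fin n => z i.succ).det := by
      intro z
      simp [det_vandermonde, Fin.prod_univ_succ, Fin.prod_Ioi_succ]
    have hs : ∀ i j, x i + y j ≠ 0 := fun i j => (add_pos (hx i) (hy j)).ne'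
    have hrow : (of fun i j : Fin (n + 1) => 1 / (x i + y j)).det =
        (of fun i j : Fin (n + 1) => if i = 0 then 1 / (x 0 + y j) else
          (x i - x 0) * (y j - y 0) / ((x i + y j) * (x i + y 0) * (x 0 + y j))).det := by
      refine det_eq_of_forall_row_eq_smul_add_const
        (fun i => if i = 0 then 0 else (x 0 + y 0) / (x i + y 0)) 0 (by simp) ?_
      intro i j
      by_cases hi : i = 0
      · simp [hi]
      · have h1 := hs i j
        have h2 := hs i 0
        have h3 := hs 0 j
        simp only [of_apply, hi, if_false, if_true]
        field_simp
        ring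
    have hcol : (of fun i j : Fin (n + 1) => 1 / (x i + y j)).det =
        1 / (x 0 + y 0) * ((∏ i : Fin n, (x i.succ - x 0) / (x i.succ + y 0)) *
          ((∏ j : Fin n, (y j.succ - y 0) / (x 0 + y j.succ)) *
            (of fun i j : Fin n => 1 / (x i.succ + y j.succ)).det)) := by
      rw [hrow, det_succ_column_zero, Fin.sum_univ_succ, Finset.sum_eq_zero, add_zero]
      · rw [← det_mul_row, ← det_mul_column]
        simp only [Fin.val_zero, pow_zero, one_mul, of_apply, if_true]
        congr 2
        ext i j
        have h1 := hs i.succ j.succ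
        have h2 := hs i.succ 0
        have h3 := hs 0 j.succ
        simp only [submatrix_apply, of_apply, Fin.succAbove_zero, Fin.succ_ne_zero, if_false]
        field_simp
      · intro i _
        simp [Fin.succ_ne_zero]
    have key := ih (fun i => x i.succ) (fun i => y i.succ) (fun i => hx _) (fun i => hy _)
      (hxi.comp (Fin.succ_injective n)) (hyi.comp (Fin.succ_injective n))
    rw [hcol, vand x, vand y]
    have hA : 0 < (∏ i : Fin n, (x i.succ - x 0)) *
        ∏ i : Fin n, (x i.succ - x 0) / (x i.succ + y 0) := by
      rw [← Finset.prod_mul_distrib]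
      refine Finset.prod_pos fun i _ => ?_
      have hne : x i.succ - x 0 ≠ 0 := sub_ne_zero.2 (hxi.ne (Fin.succ_ne_zero i))
      have := add_pos (hx i.succ) (hy 0)
      rw [mul_div_assoc']
      exact div_pos (mul_self_pos.2 hne) this
    have hB : 0 < (∏ i : Fin n, (y i.succ - y 0)) *
        ∏ i : Fin n, (y i.succ - y 0) / (x 0 + y i.succ) := by
      rw [← Finset.prod_mul_distrib]
      refine Finset.prod_pos fun i _ => ?_
      have hne : y i.succ - y 0 ≠ 0 := sub_ne_zero.2 (hyi.ne (Fin.succ_ne_zero i))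
      have := add_pos (hx 0) (hy i.succ)
      rw [mul_div_assoc']
      exact div_pos (mul_self_pos.2 hne) this
    have h0 : 0 < 1 / (x 0 + y 0) := one_div_pos.2 (add_pos (hx 0) (hy 0))
    have := mul_pos (mul_pos (mul_pos h0 hA) hB) key
    refine this.trans_eq ?_
    ring

section Andreief

lemma det_mul_det_eq_sum_sum {α : Type*} {n : ℕ} (f g : Fin n → α → ℝ) (x : Fin n → α) :
    (of fun i k : Fin n => f i (x k)).det * (of fun i k : Fin n => g i (x k)).det =
      ∑ σ : Equiv.Perm (Fin n), ∑ τ : Equiv.Perm (Fin n),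
        ((Equiv.Perm.sign σ : ℤ) : ℝ) * ((Equiv.Perm.sign τ : ℤ) : ℝ) *
          ∏ k, (f (σ k) (x k) * g (τ k) (x k)) := by
  simp only [det_apply', of_apply, Finset.sum_mul_sum, Finset.prod_mul_distrib]
  refine Finset.sum_congr rfl fun σ _ => Finset.sum_congr rfl fun τ _ => ?_
  ring

variable {α : Type*} [MeasurableSpace α] {μ : Measure α} [SigmaFinite μ] {n : ℕ}
  {f g : Fin n → α → ℝ}

lemma integrable_det_mul_det (h : ∀ i j, Integrable (fun a => f i a * g j a) μ) :
    Integrable (fun x : Fin n → α => (of fun i k : Fin n => f i (x k)).det *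
      (of fun i k : Fin n => g i (x k)).det) (Measure.pi fun _ => μ) := by
  simp only [det_mul_det_eq_sum_sum]
  exact integrable_finsetSum _ fun σ _ => integrable_finsetSum _ fun τ _ =>
    (Integrable.fintype_prod (f := fun k a => f (σ k) a * g (τ k) a)
      fun k => h (σ k) (τ k)).const_mul _

/-- **Andréief's identity**. -/
lemma integral_det_mul_det (h : ∀ i j, Integrable (fun a => f i a * g j a) μ) :
    ∫ x : Fin n → α, (of fun i k : Fin n => f i (x k)).det *
      (of fun i k : Fin n => g i (x k)).det ∂(Measure.pi fun _ => μ) =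
      n.factorial * (of fun i j : Fin n => ∫ a, f i a * g j a ∂μ).det := by
  have hint : ∀ σ τ : Equiv.Perm (Fin n), Integrable (fun x : Fin n → α =>
      ((Equiv.Perm.sign σ : ℤ) : ℝ) * ((Equiv.Perm.sign τ : ℤ) : ℝ) *
          ∏ k, (f (σ k) (x k) * g (τ k) (x k))) (Measure.pi fun _ => μ) := fun σ τ =>
    (Integrable.fintype_prod (f := fun k a => f (σ k) a * g (τ k) a)
      fun k => h (σ k) (τ k)).const_mul _
  set M : Matrix (Fin n) (Fin n) ℝ := of fun i j : Fin n => ∫ a, f i a * g j a ∂μ with hM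
  simp only [det_mul_det_eq_sum_sum]
  rw [integral_finsetSum _ fun σ _ => integrable_finsetSum _ fun τ _ => hint σ τ]
  have hσ : ∀ σ : Equiv.Perm (Fin n), ∫ x : Fin n → α, ∑ τ : Equiv.Perm (Fin n),
      ((Equiv.Perm.sign σ : ℤ) : ℝ) * ((Equiv.Perm.sign τ : ℤ) : ℝ) *
          ∏ k, (f (σ k) (x k) * g (τ k) (x k)) ∂(Measure.pi fun _ => μ) = M.det := by
    intro σ
    rw [integral_finsetSum _ fun τ _ => hint σ τ]
    have hdet : M.det = ((Equiv.Perm.sign σ : ℤ) : ℝ) * (M.submatrix σ id)ᵀ.det := by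
      rw [det_transpose, det_permute, ← mul_assoc, ← Int.cast_mul, Int.units_coe_mul_self]
      simp
    rw [hdet, det_apply', Finset.mul_sum]
    refine Finset.sum_congr rfl fun τ _ => ?_
    rw [integral_const_mul, mul_assoc,
      integral_fintype_prod_eq_prod (fun k a => f (σ k) a * g (τ k) a)]
    simp [hM]
  simp [hσ, Fintype.card_perm]

end Andreief

lemma pi_restrict_injective_pos (n : ℕ) :
    0 < (Measure.pi fun _ : Fin n => volume.restrict (Ioo (0:ℝ) 1))
      {x : Fin n → ℝ | Function.Injective x ∧ ∀ k, x k ∈ Ioo (0:ℝ) 1} := by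
  have hpos : ∀ k : Fin n, (0:ℝ) < n := fun k => by exact_mod_cast k.pos
  have hbox : ∀ (k : Fin n) (z : ℝ), z ∈ Ioo ((k:ℝ) / n) (((k:ℝ) + 1) / n) →
      (k:ℝ) < z * n ∧ z * n < k + 1 := fun k z hz =>
    ⟨(div_lt_iff₀ (hpos k)).1 hz.1, (lt_div_iff₀ (hpos k)).1 hz.2⟩
  have hsub : ∀ k : Fin n, Ioo ((k:ℝ) / n) (((k:ℝ) + 1) / n) ⊆ Ioo 0 1 := by
    refine fun k => Ioo_subset_Ioo (by positivity) ((div_le_one (hpos k)).2 ?_)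
    exact_mod_cast k.isLt
  refine lt_of_lt_of_le ?_ (measure_mono
    (s := univ.pi fun k : Fin n => Ioo ((k:ℝ) / n) (((k:ℝ) + 1) / n)) ?_)
  · rw [Measure.pi_pi, pos_iff_ne_zero, Finset.prod_ne_zero_iff]
    intro k _
    rw [Measure.restrict_apply measurableSet_Ioo, inter_eq_left.2 (hsub k)]
    refine ((Measure.measure_Ioo_pos _).2 ?_).ne'
    exact div_lt_div_of_pos_right (by linarith) (hpos k)
  · intro x hx
    have hx' : ∀ k : Fin n, x k ∈ Ioo ((k:ℝ) / n) (((k:ℝ) + 1) / n) := fun k => hx k (mem_univ k)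
    refine ⟨fun k l hkl => ?_, fun k => hsub k (hx' k)⟩
    have h1 := hbox k _ (hx' k)
    have h2 := hbox l _ (hx' l)
    rw [hkl] at h1
    have h3 : (k:ℝ) < l + 1 := h1.1.trans h2.2
    have h4 : (l:ℝ) < k + 1 := h2.1.trans h1.2
    have h5 : (k:ℕ) < l + 1 := by exact_mod_cast h3
    have h6 : (l:ℕ) < k + 1 := by exact_mod_cast h4
    exact Fin.ext (by omega)

/-- A continuous Cauchy–Binet positivity criterion on the unit interval. -/
lemma det_integral_mul_pos {n : ℕ} {f g : Fin n → ℝ → ℝ} (c : ℝ)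
    (hint : ∀ i j, IntegrableOn (fun a => f i a * g j a) (Ioo 0 1))
    (hpos : ∀ x : Fin n → ℝ, (∀ k : Fin n, x k ∈ Ioo (0:ℝ) 1) → Function.Injective x →
      0 < c * ((of fun i k : Fin n => f i (x k)).det * (of fun i k : Fin n => g i (x k)).det)) :
    0 < c * (of fun i j : Fin n => ∫ a in Ioo (0:ℝ) 1, f i a * g j a).det := by
  have hI := (integrable_det_mul_det hint).const_mul c
  have hfac : (0:ℝ) < n.factorial := by exact_mod_cast n.factorial_pos
  refine pos_of_mul_pos_right (a := (n.factorial : ℝ)) ?_ hfac.le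
  rw [mul_left_comm, ← integral_det_mul_det hint, ← integral_const_mul,
    integral_pos_iff_support_of_nonneg_ae ?_ hI]
  · exact (pi_restrict_injective_pos n).trans_le
      (measure_mono fun x hx => (hpos x hx.2 hx.1).ne')
  · rw [← Measure.restrict_pi_pi]
    refine ae_restrict_of_forall_mem (MeasurableSet.univ_pi fun _ => measurableSet_Ioo) ?_
    intro x hx
    by_cases hinj : Function.Injective x
    · exact (hpos x (fun k => hx k (mem_univ k)) hinj).le
    · obtain ⟨k, l, hkl, hne⟩ : ∃ k l, x k = x l ∧ k ≠ l := by
        simpa [Function.Injective] using hinj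
      have : (of fun i k : Fin n => f i (x k)).det = 0 :=
        det_zero_of_column_eq hne fun i => by simp [hkl]
      simp [this]

lemma det_pow_mul {n : ℕ} (u : ℝ → ℝ) (x : Fin n → ℝ) :
    (of fun i k : Fin n => x k ^ (i : ℕ) * u (x k)).det =
      (∏ k, u (x k)) * (vandermonde x).det := by
  rw [← det_transpose (vandermonde x), ← det_mul_row]
  congr 1
  ext i k
  simp [mul_comm]

lemma integrableOn_one_div_add :
    IntegrableOn (fun p : ℝ × ℝ => 1 / (p.1 + p.2)) (Ioo (0:ℝ) 1 ×ˢ Ioo (0:ℝ) 1) := by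
  have h : IntegrableOn (fun x : ℝ => x ^ (-(1/2) : ℝ)) (Ioo 0 1) :=
    (intervalIntegral.integrableOn_Ioo_rpow_iff one_pos).2 (by norm_num)
  have h2 := h.mul_prod h
  rw [Measure.prod_restrict] at h2
  refine Integrable.mono' h2 (Measurable.aestronglyMeasurable (by fun_prop)) ?_
  refine ae_restrict_of_forall_mem (measurableSet_Ioo.prod measurableSet_Ioo) ?_
  rintro ⟨x, y⟩ ⟨⟨hx, -⟩, ⟨hy, -⟩⟩
  simp only at hx hy ⊢
  rw [Real.norm_of_nonneg (by positivity), Real.rpow_neg hx.le, Real.rpow_neg hy.le,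
    ← mul_inv, one_div, ← Real.sqrt_eq_rpow, ← Real.sqrt_eq_rpow]
  have hsx := Real.sqrt_pos.2 hx
  have hsy := Real.sqrt_pos.2 hy
  refine inv_anti₀ (by positivity) ?_
  nlinarith [Real.sq_sqrt hx.le, Real.sq_sqrt hy.le, sq_nonneg (√x - √y), mul_pos hsx hsy]

/-- Bimoment determinants of the Cauchy kernel with bounded positive weights are positive. -/
lemma det_cauchy_bimoment_pos {u v : ℝ → ℝ} (hu : Measurable u) (hv : Measurable v)
    (hu0 : ∀ x ∈ Ioo (0:ℝ) 1, 0 < u x) (hv0 : ∀ x ∈ Ioo (0:ℝ) 1, 0 < v x)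
    (hu1 : ∀ x ∈ Ioo (0:ℝ) 1, u x ≤ 1) (hv1 : ∀ x ∈ Ioo (0:ℝ) 1, v x ≤ 1) (n : ℕ) :
    0 < (of fun i j : Fin n => ∫ p in Ioo (0:ℝ) 1 ×ˢ Ioo (0:ℝ) 1,
      p.1 ^ (i : ℕ) * u p.1 * (1 / (p.1 + p.2) * (p.2 ^ (j : ℕ) * v p.2))).det := by
  have hb : ∀ {w : ℝ → ℝ}, (∀ x ∈ Ioo (0:ℝ) 1, 0 < w x) → (∀ x ∈ Ioo (0:ℝ) 1, w x ≤ 1) →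
      ∀ (i : ℕ), ∀ x ∈ Ioo (0:ℝ) 1, 0 ≤ x ^ i * w x ∧ x ^ i * w x ≤ 1 :=
    fun h0 h1 i x hx => ⟨mul_nonneg (pow_nonneg hx.1.le i) (h0 x hx).le,
      mul_le_one₀ (pow_le_one₀ hx.1.le hx.2.le) (h0 x hx).le (h1 x hx)⟩
  have hprod : ∀ i j : ℕ, IntegrableOn (fun p : ℝ × ℝ =>
      p.1 ^ i * u p.1 * (1 / (p.1 + p.2) * (p.2 ^ j * v p.2)))
      (Ioo (0:ℝ) 1 ×ˢ Ioo (0:ℝ) 1) := by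
    intro i j
    refine Integrable.mono' integrableOn_one_div_add
      (Measurable.aestronglyMeasurable (by fun_prop)) ?_
    refine ae_restrict_of_forall_mem (measurableSet_Ioo.prod measurableSet_Ioo) ?_
    rintro ⟨x, y⟩ ⟨hx, hy⟩
    simp only at hx hy ⊢
    obtain ⟨ha0, ha1⟩ := hb hu0 hu1 i x hx
    obtain ⟨hb0, hb1⟩ := hb hv0 hv1 j y hy
    have hk : 0 < 1 / (x + y) := one_div_pos.2 (add_pos hx.1 hy.1)
    rw [Real.norm_of_nonneg (by positivity)]
    calc _ ≤ 1 * (1 / (x + y) * 1) := by gcongr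
      _ = _ := by ring
  have hinner : ∀ x : ℝ, 0 < x → ∀ j : ℕ,
      IntegrableOn (fun y : ℝ => 1 / (x + y) * (y ^ j * v y)) (Ioo 0 1) := by
    intro x hx j
    refine Integrable.mono' (g := fun _ => 1 / x) (by simp)
      (Measurable.aestronglyMeasurable (by fun_prop)) ?_
    refine ae_restrict_of_forall_mem measurableSet_Ioo fun y hy => ?_
    obtain ⟨hb0, hb1⟩ := hb hv0 hv1 j y hy
    have hy0 := hy.1
    rw [Real.norm_of_nonneg (by positivity)]
    calc _ ≤ 1 / x * 1 := by gcongr; linarith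
      _ = _ := by ring
  have hfub : ∀ i j : ℕ, ∫ p in Ioo (0:ℝ) 1 ×ˢ Ioo (0:ℝ) 1,
      p.1 ^ i * u p.1 * (1 / (p.1 + p.2) * (p.2 ^ j * v p.2)) =
      ∫ x in Ioo (0:ℝ) 1, x ^ i * u x * ∫ y in Ioo (0:ℝ) 1, 1 / (x + y) * (y ^ j * v y) := by
    intro i j
    rw [Measure.volume_eq_prod, setIntegral_prod _ (hprod i j)]
    simp only [integral_const_mul]
  simp only [hfub]
  rw [← one_mul (det _)]
  refine det_integral_mul_pos (f := fun i x => x ^ (i : ℕ) * u x)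
    (g := fun j x => ∫ y in Ioo (0:ℝ) 1, 1 / (x + y) * (y ^ (j : ℕ) * v y)) 1 ?_ ?_
  · intro i j
    have h := hprod i j
    rw [IntegrableOn, Measure.volume_eq_prod, ← Measure.prod_restrict] at h
    have h' := h.integral_prod_left
    simp only [integral_const_mul] at h'
    exact h'
  · intro x hx hxi
    have hstep := det_integral_mul_pos (f := fun (k : Fin n) y => 1 / (x k + y))
      (g := fun j y => y ^ (j : ℕ) * v y) (vandermonde x).det
      (fun k j => hinner (x k) (hx k).1 j) (by
        intro y hy hyi
        rw [det_pow_mul]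
        have h1 := det_cauchy_mul_vandermonde_pos x y (fun k => (hx k).1) (fun k => (hy k).1)
          hxi hyi
        have h2 : 0 < ∏ k, v (y k) := Finset.prod_pos fun k _ => hv0 _ (hy k)
        have := mul_pos h2 h1
        refine this.trans_eq ?_
        ring)
    rw [det_pow_mul, one_mul, mul_assoc]
    refine mul_pos (Finset.prod_pos fun k _ => hu0 _ (hx k)) ?_
    rw [← det_transpose (of _)] at hstep
    exact hstep

lemma measurable_weight (a t : ℕ) :
    Measurable fun x : ℝ => x ^ a * ((1 - x) / (1 + x)) ^ t := by fun_prop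

lemma weight_pos (a t : ℕ) {x : ℝ} (hx : x ∈ Ioo (0:ℝ) 1) :
    0 < x ^ a * ((1 - x) / (1 + x)) ^ t :=
  mul_pos (pow_pos hx.1 a)
    (pow_pos (div_pos (sub_pos.2 hx.2) (add_pos one_pos hx.1)) t)

lemma weight_le_one (a t : ℕ) {x : ℝ} (hx : x ∈ Ioo (0:ℝ) 1) :
    x ^ a * ((1 - x) / (1 + x)) ^ t ≤ 1 := by
  have h1 : 0 < 1 + x := add_pos one_pos hx.1
  have h0 : 0 ≤ (1 - x) / (1 + x) := div_nonneg (sub_pos.2 hx.2).le h1.le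
  refine mul_le_one₀ (pow_le_one₀ hx.1.le hx.2.le) (pow_nonneg h0 t) (pow_le_one₀ h0 ?_)
  rw [div_le_one h1]
  linarith [hx.1]

lemma det_mom_shift_pos (s t d n : ℕ) :
    0 < (of fun i j : Fin n => mom s t i ((j : ℕ) + d)).det := by
  have h := det_cauchy_bimoment_pos (measurable_weight s t) (measurable_weight (s + d) t)
    (fun x hx => weight_pos s t hx) (fun x hx => weight_pos (s + d) t hx)
    (fun x hx => weight_le_one s t hx) (fun x hx => weight_le_one (s + d) t hx) n
  convert h using 5 with i j
  unfold mom
  congr 1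
  ext p
  ring

/-- strict positivity of `τ_n^{s,t}` and `ξ_n^{s,t}`; in particular the
normalization constants `h_n^{s,t} = τ_{n+1}^{s,t}/τ_n^{s,t}` are nonzero. -/
theorem tau_pos_xi_pos (s t n : ℕ) :
    0 < tau s t n ∧ 0 < xi s t n ∧ tau s t (n + 1) / tau s t n ≠ 0 :=
  ⟨det_mom_shift_pos s t 0 n, det_mom_shift_pos s t 1 n,
    (div_pos (det_mom_shift_pos s t 0 (n + 1)) (det_mom_shift_pos s t 0 n)).ne'⟩
end

section
/- For all s,t ∈ ℕ and all real polynomials f,g, the two-parameter deformed Cauchy inner product satisfies ⟨f, g⟩_{s,t+1} = ⟨f, g⟩_{s,t} − L_{s,t}(f)·L_{s,t}(g). In particular the bimoments satisfy m_{i,j}^{s,t+1} = m_{i,j}^{s,t} − φ_i^{s,t}φ_j^{s,t}, where φ_i^{s,t} = L_{s,t}(x^i). -/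
open MeasureTheory

/-- The Cauchy kernel is integrable on the unit square, by comparison with
`(x * y) ^ (-1 / 2)`. -/
theorem integrableOn_mul_div_add {u v : ℝ → ℝ} (hu : ContinuousOn u (Set.Icc 0 1))
    (hv : ContinuousOn v (Set.Icc 0 1)) :
    IntegrableOn (fun p : ℝ × ℝ => u p.1 * v p.2 / (p.1 + p.2))
      (Set.Ioo (0:ℝ) 1 ×ˢ Set.Ioo (0:ℝ) 1) := by
  obtain ⟨A, hA⟩ := isCompact_Icc.exists_bound_of_continuousOn hu
  obtain ⟨B, hB⟩ := isCompact_Icc.exists_bound_of_continuousOn hv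
  have hpow : IntegrableOn (fun x : ℝ => x ^ (-1 / 2 : ℝ)) (Set.Ioo 0 1) :=
    (intervalIntegral.integrableOn_Ioo_rpow_iff one_pos).2 (by norm_num)
  have hprod : IntegrableOn
      (fun p : ℝ × ℝ => A * B * (p.1 ^ (-1 / 2 : ℝ) * p.2 ^ (-1 / 2 : ℝ)))
      (Set.Ioo (0:ℝ) 1 ×ˢ Set.Ioo (0:ℝ) 1) := by
    rw [IntegrableOn, Measure.volume_eq_prod, ← Measure.prod_restrict]
    exact (hpow.mul_prod hpow).const_mul _
  have hmeas : MeasurableSet (Set.Ioo (0:ℝ) 1 ×ˢ Set.Ioo (0:ℝ) 1) :=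
    measurableSet_Ioo.prod measurableSet_Ioo
  refine Integrable.mono' hprod (ContinuousOn.aestronglyMeasurable ?_ hmeas) ?_
  · refine ContinuousOn.div (ContinuousOn.mul ?_ ?_) (by fun_prop) ?_
    · exact hu.comp (by fun_prop) fun p hp => Set.Ioo_subset_Icc_self hp.1
    · exact hv.comp (by fun_prop) fun p hp => Set.Ioo_subset_Icc_self hp.2
    · exact fun p hp => (add_pos hp.1.1 hp.2.1).ne'
  · filter_upwards [ae_restrict_mem hmeas] with p hp
    obtain ⟨x, y⟩ := p
    obtain ⟨hx, hy⟩ := hp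
    have hx0 : 0 < x := hx.1
    have hy0 : 0 < y := hy.1
    have hAx := hA x (Set.Ioo_subset_Icc_self hx)
    have hBy := hB y (Set.Ioo_subset_Icc_self hy)
    have hA0 : 0 ≤ A := (norm_nonneg _).trans hAx
    have hB0 : 0 ≤ B := (norm_nonneg _).trans hBy
    have hAB : 0 ≤ A * B := mul_nonneg hA0 hB0
    have hkernel : (x + y)⁻¹ ≤ x ^ (-1 / 2 : ℝ) * y ^ (-1 / 2 : ℝ) := by
      rw [neg_div, Real.rpow_neg hx0.le, Real.rpow_neg hy0.le, ← Real.sqrt_eq_rpow,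
        ← Real.sqrt_eq_rpow, ← mul_inv]
      have hsx := Real.sqrt_pos.2 hx0
      have hsy := Real.sqrt_pos.2 hy0
      refine inv_anti₀ (mul_pos hsx hsy) ?_
      nlinarith [Real.sq_sqrt hx0.le, Real.sq_sqrt hy0.le, sq_nonneg (√x - √y), mul_pos hsx hsy]
    have hnorm : ‖u x * v y / (x + y)‖ = ‖u x‖ * ‖v y‖ * (x + y)⁻¹ := by
      rw [norm_div, norm_mul, Real.norm_of_nonneg (add_pos hx0 hy0).le, div_eq_mul_inv]
    dsimp only
    rw [hnorm]
    gcongr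

/-- The evolution of the deformed Cauchy inner product in `t`, for continuous functions. -/
theorem innerF_succ (s t : ℕ) {f g : ℝ → ℝ} (hf : Continuous f) (hg : Continuous g) :
    innerF s (t + 1) f g = innerF s t f g - LF s t f * LF s t g := by
  have hweight : ∀ {h : ℝ → ℝ}, Continuous h →
      ContinuousOn (fun x => x ^ s * h x * ((1 - x) / (1 + x)) ^ t) (Set.Icc 0 1) := by
    intro h hh
    refine ContinuousOn.mul (by fun_prop) (ContinuousOn.pow ?_ t)
    exact ContinuousOn.div (by fun_prop) (by fun_prop) fun x hx => by linarith [hx.1]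
  have hsingle : ∀ {h : ℝ → ℝ}, Continuous h →
      IntegrableOn (fun x => (x ^ s / (1 + x)) * h x * ((1 - x) / (1 + x)) ^ t)
        (Set.Ioo 0 1) := by
    intro h hh
    refine (ContinuousOn.integrableOn_Icc ?_).mono_set Set.Ioo_subset_Icc_self
    refine ((hweight hh).div (by fun_prop : ContinuousOn (fun x : ℝ => 1 + x) _)
      fun x hx => by linarith [hx.1]).congr fun x _ => ?_
    rw [Pi.div_apply]
    ring
  have hmeas : MeasurableSet (Set.Ioo (0:ℝ) 1 ×ˢ Set.Ioo (0:ℝ) 1) :=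
    measurableSet_Ioo.prod measurableSet_Ioo
  have hinner : IntegrableOn (fun p : ℝ × ℝ => (p.1 ^ s * p.2 ^ s / (p.1 + p.2)) * f p.1 * g p.2 *
      ((1 - p.1) / (1 + p.1)) ^ t * ((1 - p.2) / (1 + p.2)) ^ t)
      (Set.Ioo (0:ℝ) 1 ×ˢ Set.Ioo (0:ℝ) 1) :=
    (integrableOn_mul_div_add (hweight hf) (hweight hg)).congr_fun
      (fun p _ => by dsimp only; ring) hmeas
  have hprod : IntegrableOn (fun p : ℝ × ℝ =>
      ((p.1 ^ s / (1 + p.1)) * f p.1 * ((1 - p.1) / (1 + p.1)) ^ t) *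
        ((p.2 ^ s / (1 + p.2)) * g p.2 * ((1 - p.2) / (1 + p.2)) ^ t))
      (Set.Ioo (0:ℝ) 1 ×ˢ Set.Ioo (0:ℝ) 1) := by
    rw [IntegrableOn, Measure.volume_eq_prod, ← Measure.prod_restrict]
    exact (hsingle hf).mul_prod (hsingle hg)
  have hLF : LF s t f * LF s t g = ∫ p in (Set.Ioo (0:ℝ) 1 ×ˢ Set.Ioo (0:ℝ) 1),
      2 * (((p.1 ^ s / (1 + p.1)) * f p.1 * ((1 - p.1) / (1 + p.1)) ^ t) *
        ((p.2 ^ s / (1 + p.2)) * g p.2 * ((1 - p.2) / (1 + p.2)) ^ t)) := by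
    rw [integral_const_mul, Measure.volume_eq_prod,
      setIntegral_prod_mul (fun x : ℝ => (x ^ s / (1 + x)) * f x * ((1 - x) / (1 + x)) ^ t)
        (fun y : ℝ => (y ^ s / (1 + y)) * g y * ((1 - y) / (1 + y)) ^ t),
      LF, LF, mul_mul_mul_comm, Real.mul_self_sqrt zero_le_two]
  rw [hLF, innerF, innerF, ← integral_sub hinner (hprod.const_mul 2)]
  refine setIntegral_congr_fun hmeas fun p hp => ?_
  have hx : 1 + p.1 ≠ 0 := by linarith [hp.1.1]
  have hy : 1 + p.2 ≠ 0 := by linarith [hp.2.1]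
  have hxy : p.1 + p.2 ≠ 0 := (add_pos hp.1.1 hp.2.1).ne'
  rw [pow_succ, pow_succ]
  generalize ((1 - p.1) / (1 + p.1)) ^ t = a
  generalize ((1 - p.2) / (1 + p.2)) ^ t = b
  field_simp
  ring

theorem mom_eq_innerF (s t i j : ℕ) :
    mom s t i j = innerF s t (fun x => x ^ i) (fun y => y ^ j) := by
  rw [mom, innerF]
  congr 1 with p
  ring

theorem phi_eq_LF (s t i : ℕ) : phi s t i = LF s t (fun x => x ^ i) := by
  rw [phi, LF]
  congr 2 with x
  ring

/-- `⟨f,g⟩_{s,t+1} = ⟨f,g⟩_{s,t} − L_{s,t}(f)·L_{s,t}(g)` for all real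
polynomials `f, g`; in particular `m_{i,j}^{s,t+1} = m_{i,j}^{s,t} − φ_i^{s,t}φ_j^{s,t}`. -/
theorem inner_t_evolution (s t : ℕ) :
    (∀ f g : Polynomial ℝ,
        innerP s (t + 1) f g = innerP s t f g - LP s t f * LP s t g) ∧
      ∀ i j : ℕ, mom s (t + 1) i j = mom s t i j - phi s t i * phi s t j := by
  refine ⟨fun f g => innerF_succ s t f.continuous g.continuous, fun i j => ?_⟩
  simp only [mom_eq_innerF, phi_eq_LF]
  exact innerF_succ s t (continuous_pow i) (continuous_pow j)
end

section
/- Assume τ_n^{s,t} ≠ 0, τ_{n−1}^{s,t} ≠ 0 and σ̃_{n−1}^{s,t} ≠ 0. Then for n ≥ 1 the combination P_n^{s,t} + a_n^{s,t} P_{n−1}^{s,t}, with a_n^{s,t} = −σ̃_n^{s,t}τ_{n−1}^{s,t}/(σ̃_{n−1}^{s,t}τ_n^{s,t}), is annihilated by the weight functional: ∫_0^1 (P_n^{s,t}(x) + a_n^{s,t} P_{n−1}^{s,t}(x)) · x^s ((1−x)/(1+x))^t dx = 0. -/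
open MeasureTheory

/-- Integrability on `(0,1)` of a power against the weight `x^s ((1-x)/(1+x))^t`. -/
theorem integrableOn_pow_mul_weight (s t i : ℕ) :
    IntegrableOn (fun x : ℝ => x ^ i * (x ^ s * ((1 - x) / (1 + x)) ^ t)) (Set.Ioo 0 1) := by
  have hc : ContinuousOn (fun x : ℝ => x ^ i * (x ^ s * ((1 - x) / (1 + x)) ^ t))
      (Set.Icc 0 1) := by
    have hd : ContinuousOn (fun x : ℝ => (1 - x) / (1 + x)) (Set.Icc 0 1) :=
      ContinuousOn.div (by fun_prop) (by fun_prop) fun x hx => by linarith [hx.1]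
    fun_prop
  exact (hc.integrableOn_compact isCompact_Icc).mono_set Set.Ioo_subset_Icc_self

/-- Laplace expansion along the last column of a bordered matrix. -/
theorem det_bordered_eq_sum (M : ℕ → ℕ → ℝ) (n : ℕ) :
    ∃ K : Fin (n + 1) → ℝ, ∀ c : ℕ → ℝ,
      Matrix.det (Matrix.of fun i j : Fin (n + 1) => if (j : ℕ) < n then M i j else c i) =
        ∑ i : Fin (n + 1), K i * c i := by
  refine ⟨fun i => (-1) ^ ((i : ℕ) + n) *
    Matrix.det (Matrix.of fun k l : Fin n => M (i.succAbove k) l), fun c => ?_⟩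
  rw [Matrix.det_succ_column _ (Fin.last n)]
  refine Finset.sum_congr rfl fun i _ => ?_
  have hsub : (Matrix.of fun i j : Fin (n + 1) =>
      if (j : ℕ) < n then M i j else c i).submatrix i.succAbove (Fin.last n).succAbove =
      Matrix.of fun k l : Fin n => M (i.succAbove k) l := by
    ext k l
    simp
  rw [hsub]
  simp only [Matrix.of_apply, Fin.val_last, lt_irrefl, if_false]
  ring

/-- `P_n^{s,t}` is integrable against the weight, with integral `σ̃_n^{s,t} / τ_n^{s,t}`. -/
theorem integrableOn_P_mul_weight_and_integral (s t n : ℕ) :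
    IntegrableOn (fun x => P s t n x * (x ^ s * ((1 - x) / (1 + x)) ^ t)) (Set.Ioo 0 1) ∧
      ∫ x in Set.Ioo (0:ℝ) 1, P s t n x * (x ^ s * ((1 - x) / (1 + x)) ^ t) =
        sigT s t n / tau s t n := by
  obtain ⟨K, hK⟩ := det_bordered_eq_sum (mom s t) n
  have hP : (fun x => P s t n x * (x ^ s * ((1 - x) / (1 + x)) ^ t)) = fun x =>
      ∑ i : Fin (n + 1),
        1 / tau s t n * K i * (x ^ (i : ℕ) * (x ^ s * ((1 - x) / (1 + x)) ^ t)) := by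
    funext x
    rw [P, hK fun i => x ^ i, Finset.mul_sum, Finset.sum_mul]
    exact Finset.sum_congr rfl fun i _ => by ring
  have hint (i : Fin (n + 1)) : IntegrableOn (fun x : ℝ =>
      1 / tau s t n * K i * (x ^ (i : ℕ) * (x ^ s * ((1 - x) / (1 + x)) ^ t)))
      (Set.Ioo 0 1) :=
    (integrableOn_pow_mul_weight s t i).const_mul _
  rw [hP]
  refine ⟨integrable_finsetSum _ fun i _ => hint i, ?_⟩
  rw [integral_finsetSum _ fun i _ => hint i, sigT, hK (momS s t), Finset.sum_div]
  refine Finset.sum_congr rfl fun i _ => ?_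
  rw [integral_const_mul, momS]
  simp only [pow_add, mul_left_comm, mul_assoc]
  ring

/-- the combination `P_n^{s,t} + a_n^{s,t}P_{n−1}^{s,t}` is annihilated
by the weight functional `f ↦ ∫_0^1 f(x) x^s ((1−x)/(1+x))^t dx`. -/
theorem weight_functional_annihilates (s t n : ℕ) (hn : 1 ≤ n)
    (h₁ : tau s t n ≠ 0) (h₂ : tau s t (n - 1) ≠ 0) (h₃ : sigT s t (n - 1) ≠ 0) :
    ∫ x in Set.Ioo (0:ℝ) 1,
        (P s t n x +
          (-(sigT s t n * tau s t (n - 1)) / (sigT s t (n - 1) * tau s t n)) *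
            P s t (n - 1) x) *
          (x ^ s * ((1 - x) / (1 + x)) ^ t) = 0 := by
  obtain ⟨hi, he⟩ := integrableOn_P_mul_weight_and_integral s t n
  obtain ⟨hi', he'⟩ := integrableOn_P_mul_weight_and_integral s t (n - 1)
  simp only [add_mul, mul_assoc]
  rw [integral_add hi (hi'.const_mul _), integral_const_mul, he, he']
  field_simp
  ring
end

section
/- Assume τ_{n+1}^{s,t} ≠ 0, τ_n^{s+1,t} ≠ 0 and ξ_n^{s,t} ≠ 0. Then the polynomial identity x·P_n^{s+1,t}(x) = P_{n+1}^{s,t}(x) + (ξ_n^{s,t}ξ_{n+1}^{s,t}/(τ_n^{s+1,t}τ_{n+1}^{s,t}))·Q_n^{s,t}(x) holds. -/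
open MeasureTheory

open Matrix in
/-- Column and row reindexing by two equivalences multiplies the determinant by a sign, which
cancels when the two equivalences are interchanged in a second factor. -/
theorem det_submatrix_mul_det_submatrix_swap {m p R : Type*} [Fintype m] [DecidableEq m]
    [Fintype p] [DecidableEq p] [CommRing R] (e₁ e₂ : m ≃ p) (A B : Matrix p p R) :
    (A.submatrix e₁ e₂).det * (B.submatrix e₂ e₁).det = A.det * B.det := by
  have key : ∀ (M : Matrix p p R) (e e' : m ≃ p),
      (M.submatrix e e').det = (Equiv.Perm.sign (e.symm.trans e') : ℤ) * M.det := by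
    intro M e e'
    rw [← det_permute', ← det_submatrix_equiv_self e (M.submatrix id (e.symm.trans e'))]
    congr 1
    ext i j
    simp
  have hs : e₂.symm.trans e₁ = (e₁.symm.trans e₂)⁻¹ := rfl
  rw [key A, key B, hs, Equiv.Perm.sign_inv]
  rcases Int.units_eq_one_or (Equiv.Perm.sign (e₁.symm.trans e₂)) with h | h <;> simp [h]

open Matrix in
/-- A bordered determinant with invertible core, via the Schur complement. -/
theorem det_fromBlocks_unit_border {m K : Type*} [Fintype m] [DecidableEq m] [Field K]
    {N : Matrix m m K} (hN : N.det ≠ 0) (u v : m → K) (d : K) :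
    (fromBlocks N (of fun i (_ : Unit) => u i) (of fun (_ : Unit) j => v j)
      (of fun _ _ => d)).det = N.det * (d - v ⬝ᵥ (N⁻¹ *ᵥ u)) := by
  have : Invertible N := invertibleOfIsUnitDet N (isUnit_iff_ne_zero.mpr hN)
  rw [det_fromBlocks₁₁, det_unique (n := Unit), invOf_eq_nonsing_inv, Matrix.mul_assoc]
  rfl

open Matrix in
/-- The Desnanot–Jacobi identity for a bordered matrix with invertible core. -/
theorem det_mul_det_fromBlocks_fin_two {m K : Type*} [Fintype m] [DecidableEq m] [Field K]
    {N : Matrix m m K} (hN : N.det ≠ 0) (U : Matrix m (Fin 2) K) (V : Matrix (Fin 2) m K)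
    (D : Matrix (Fin 2) (Fin 2) K) :
    let b (i j : Fin 2) : K := (fromBlocks N (of fun k (_ : Unit) => U k j)
      (of fun (_ : Unit) k => V i k) (of fun _ _ => D i j)).det
    N.det * (fromBlocks N U V D).det = b 0 0 * b 1 1 - b 0 1 * b 1 0 := by
  intro b
  have hb : ∀ i j, b i j = N.det * (D - V * (N⁻¹ * U)) i j := fun i j =>
    det_fromBlocks_unit_border hN (fun k => U k j) (V i) (D i j)
  have : Invertible N := invertibleOfIsUnitDet N (isUnit_iff_ne_zero.mpr hN)
  rw [det_fromBlocks₁₁, invOf_eq_nonsing_inv, Matrix.mul_assoc, det_fin_two]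
  simp only [hb]
  ring

/-- `Fin n` followed by one extra point, placed at `0`. -/
noncomputable def finSumUnitEquivZero (n : ℕ) : Fin n ⊕ Unit ≃ Fin (n + 1) :=
  Equiv.ofBijective (Sum.elim Fin.succ fun _ => 0) <| by
    rw [Fintype.bijective_iff_injective_and_card]
    refine ⟨?_, by simp⟩
    rintro (i | i) (j | j) h <;> simp_all [Fin.ext_iff]

/-- `Fin n` followed by one extra point, placed at the end. -/
noncomputable def finSumUnitEquivLast (n : ℕ) : Fin n ⊕ Unit ≃ Fin (n + 1) :=
  Equiv.ofBijective (Sum.elim Fin.castSucc fun _ => Fin.last n) <| by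
    rw [Fintype.bijective_iff_injective_and_card]
    refine ⟨?_, by simp⟩
    rintro (i | i) (j | j) h <;> simp_all [Fin.ext_iff] <;> omega

/-- `Fin n` as the interior of `Fin (n + 2)`, with two extra points placed at the ends. -/
noncomputable def finSumFinTwoEquivEnds (n : ℕ) : Fin n ⊕ Fin 2 ≃ Fin (n + 2) :=
  Equiv.ofBijective (Sum.elim (fun i => i.castSucc.succ) ![0, Fin.last (n + 1)]) <| by
    rw [Fintype.bijective_iff_injective_and_card]
    refine ⟨?_, by simp⟩
    rintro (i | i) (j | j) h
    · simpa using h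
    · fin_cases j <;> simp [Fin.ext_iff] at h
      omega
    · fin_cases i <;> simp [Fin.ext_iff] at h
      omega
    · fin_cases i <;> fin_cases j <;> simp_all [Fin.ext_iff]

open Matrix in
/-- The Desnanot–Jacobi identity for matrices whose interior minor does not vanish. -/
theorem det_interior_mul_det {K : Type*} [Field K] {n : ℕ}
    (A : Matrix (Fin (n + 2)) (Fin (n + 2)) K)
    (hN : (A.submatrix (fun i : Fin n => i.castSucc.succ) fun i => i.castSucc.succ).det ≠ 0) :
    (A.submatrix (fun i : Fin n => i.castSucc.succ) fun i => i.castSucc.succ).det * A.det =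
      (A.submatrix Fin.castSucc Fin.castSucc).det * (A.submatrix Fin.succ Fin.succ).det -
        (A.submatrix Fin.castSucc Fin.succ).det * (A.submatrix Fin.succ Fin.castSucc).det := by
  have h := det_mul_det_fromBlocks_fin_two hN
    (of fun i j => A i.castSucc.succ (finSumFinTwoEquivEnds n (Sum.inr j)))
    (of fun i j => A (finSumFinTwoEquivEnds n (Sum.inr i)) j.castSucc.succ)
    (of fun i j => A (finSumFinTwoEquivEnds n (Sum.inr i)) (finSumFinTwoEquivEnds n (Sum.inr j)))
  rw [← det_submatrix_equiv_self (finSumFinTwoEquivEnds n) A,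
    ← det_submatrix_mul_det_submatrix_swap (finSumUnitEquivZero n) (finSumUnitEquivLast n)
      (A.submatrix Fin.castSucc Fin.succ),
    ← det_submatrix_equiv_self (finSumUnitEquivZero n) (A.submatrix Fin.castSucc Fin.castSucc),
    ← det_submatrix_equiv_self (finSumUnitEquivLast n) (A.submatrix Fin.succ Fin.succ)]
  convert! h using 2
  · congr 1
    ext (i | i) (j | j) <;> rfl
  all_goals
    congr 1 <;> congr 1 <;> ext (i | i) (j | j) <;> rfl

/-- the discrete transformation
`x·P_n^{s+1,t} = P_{n+1}^{s,t} + (ξ_n^{s,t}ξ_{n+1}^{s,t}/(τ_n^{s+1,t}τ_{n+1}^{s,t}))·Q_n^{s,t}`. -/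
theorem christoffel_type_transformation (s t n : ℕ)
    (h₁ : tau s t (n + 1) ≠ 0) (h₂ : tau (s + 1) t n ≠ 0) (h₃ : xi s t n ≠ 0) (x : ℝ) :
    x * P (s + 1) t n x =
      P s t (n + 1) x +
        (xi s t n * xi s t (n + 1) / (tau (s + 1) t n * tau s t (n + 1))) * Q s t n x := by
  set A : Matrix (Fin (n + 2)) (Fin (n + 2)) ℝ :=
    Matrix.of fun i j => if (j : ℕ) < n + 1 then mom s t i j else x ^ (i : ℕ) with hA
  have hcore : (A.submatrix (fun i : Fin n => i.castSucc.succ) fun i => i.castSucc.succ).det =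
      tau (s + 1) t n := by
    unfold tau
    congr 1
    ext i j
    simp [hA, mom_succ_left]
  have hτ : (A.submatrix Fin.castSucc Fin.castSucc).det = tau s t (n + 1) := by
    unfold tau
    congr 1
    ext i j
    simp [hA, (Nat.lt_succ_iff.mp j.isLt).not_gt]
  have hξ : (A.submatrix Fin.succ Fin.castSucc).det = xi s t (n + 1) := by
    unfold xi
    rw [← Matrix.det_transpose]
    congr 1
    ext i j
    simp [hA, mom_comm s t i, (Nat.lt_succ_iff.mp i.isLt).not_gt]
  have hP : (A.submatrix Fin.succ Fin.succ).det = x * (tau (s + 1) t n * P (s + 1) t n x) := by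
    have hx : ∏ j : Fin (n + 1), (if (j : ℕ) < n then 1 else x) = x := by
      simp [Fin.prod_univ_castSucc]
    rw [P, ← mul_assoc (tau _ _ _), mul_one_div_cancel h₂, one_mul]
    nth_rewrite 1 [← hx]
    rw [← Matrix.det_mul_row]
    congr 1
    ext i j
    by_cases hj : (j : ℕ) < n
    · simp [hA, hj, mom_succ_left]
    · simp [hA, hj, pow_succ']
  have hQ : (A.submatrix Fin.castSucc Fin.succ).det = xi s t n * Q s t n x := by
    rw [Q, ← mul_assoc, mul_one_div_cancel h₃, one_mul]
    congr 1
    ext i j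
    simp [hA]
  have hdet : A.det = tau s t (n + 1) * P s t (n + 1) x := by
    rw [P, ← mul_assoc, mul_one_div_cancel h₁, one_mul]
  have key := det_interior_mul_det A (hcore ▸ h₂)
  rw [hcore, hτ, hξ, hP, hQ, hdet] at key
  field_simp
  linear_combination -key
end
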